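/- Let m ≥ 3 be an odd integer and let p be an odd prime such that 2m^p − 1 is a square-free integer. Then p divides the class number of the imaginary quadratic field ℚ(√(1 − 2m^p)). -/

import Mathlib

open Polynomial NumberField

/-- A fixed choice of complex square root of the integer `d`. -/
noncomputable def sqrtC (d : ℤ) : ℂ := (d : ℂ) ^ ((1 : ℂ) / 2)

lemma sqrtC_sq (d : ℤ) : sqrtC d ^ 2 = (d : ℂ) := by
  unfold sqrtC
  rcases eq_or_ne (d : ℂ) 0 with h | h
  · rw [h, Complex.zero_cpow (by norm_num : (1 : ℂ) / 2 ≠ 0)]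
    simp
  · rw [pow_two, ← Complex.cpow_add _ _ h]
    norm_num

lemma isIntegral_sqrtC (d : ℤ) : IsIntegral ℚ (sqrtC d) := by
  refine ⟨X ^ 2 - C (d : ℚ), monic_X_pow_sub_C _ two_ne_zero, ?_⟩
  have : (Polynomial.aeval (sqrtC d)) (X ^ 2 - C (d : ℚ)) = 0 := by
    simp [sqrtC_sq]
  simpa [Polynomial.aeval_def] using this

/-- The (number) field `ℚ(√d)`, realized as a subfield of `ℂ`. -/
noncomputable def Qsqrt (d : ℤ) : IntermediateField ℚ ℂ :=
  IntermediateField.adjoin ℚ {sqrtC d}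

instance (d : ℤ) : FiniteDimensional ℚ (Qsqrt d) :=
  IntermediateField.adjoin.finiteDimensional (isIntegral_sqrtC d)

instance (d : ℤ) : NumberField (Qsqrt d) := ⟨⟩

lemma mem_Qsqrt (d : ℤ) (x : ℂ) (hx : x ∈ Qsqrt d) :
    ∃ a b : ℚ, x = a + b * sqrtC d := by
  have h : x ∈ Algebra.adjoin ℚ {sqrtC d} := by
    rw [← IntermediateField.adjoin_simple_toSubalgebra_of_isAlgebraic
      (isIntegral_sqrtC d).isAlgebraic]
    exact hx
  clear hx
  induction h using Algebra.adjoin_induction with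
  | mem x hx =>
    rw [Set.mem_singleton_iff] at hx
    exact ⟨0, 1, by simp [hx]⟩
  | algebraMap r => exact ⟨r, 0, by simp⟩
  | add x y hx hy h1 h2 =>
    obtain ⟨a, b, rfl⟩ := h1
    obtain ⟨a', b', rfl⟩ := h2
    exact ⟨a + a', b + b', by push_cast; ring⟩
  | mul x y hx hy h1 h2 =>
    obtain ⟨a, b, rfl⟩ := h1
    obtain ⟨a', b', rfl⟩ := h2
    refine ⟨a * a' + b * b' * d, a * b' + a' * b, ?_⟩
    push_cast
    linear_combination (b * b' : ℂ) * sqrtC_sq d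

lemma conj_sqrtC (d : ℤ) (hd : d < 0) :
    (starRingEnd ℂ) (sqrtC d) = - sqrtC d := by
  have h := sqrtC_sq d
  have hre := congrArg Complex.re h
  have him := congrArg Complex.im h
  simp [pow_two] at hre him
  have hd' : (d : ℝ) < 0 := by exact_mod_cast hd
  have h0 : (sqrtC d).re = 0 := by
    by_contra h1
    have : (sqrtC d).im = 0 := by
      have : (sqrtC d).re * (sqrtC d).im = 0 := by linarith
      exact (mul_eq_zero.mp this).resolve_left h1
    rw [this] at hre
    nlinarith [mul_self_nonneg (sqrtC d).re]
  apply Complex.ext <;> simp [h0]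

lemma rat_int_of_isIntegral (q : ℚ) (h : IsIntegral ℤ (q : ℂ)) : ∃ n : ℤ, q = n := by
  have h' : IsIntegral ℤ q :=
    (isIntegral_algebraMap_iff (A := ℚ) (B := ℂ) (algebraMap ℚ ℂ).injective).mp (by simpa using h)
  obtain ⟨n, hn⟩ := IsIntegrallyClosed.isIntegral_iff.mp h'
  exact ⟨n, by simpa using hn.symm⟩

lemma rat_int_of_squarefree (e : ℤ) (he : Squarefree e) (b : ℚ) (k : ℤ) (h : e * b ^ 2 = k) :
    ∃ n : ℤ, b = n := by
  have hden : (b.den : ℚ) ≠ 0 := by exact_mod_cast b.den_nz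
  have h1 : e * b.num ^ 2 = k * (b.den : ℤ) ^ 2 := by
    have : (e * b.num ^ 2 : ℚ) = k * (b.den : ℚ) ^ 2 := by
      rw [← h]
      nth_rw 2 [← Rat.num_div_den b]
      field_simp
    exact_mod_cast this
  have hc : IsCoprime ((b.den : ℤ) ^ 2) (b.num ^ 2) := by
    apply IsCoprime.pow
    rw [Int.isCoprime_iff_gcd_eq_one, Int.gcd_comm]
    simpa [Int.gcd] using b.reduced
  have h2 : (b.den : ℤ) ^ 2 ∣ e := hc.dvd_of_dvd_mul_right ⟨k, by rw [h1]; ring⟩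
  have h3 := he (b.den : ℤ) (by rwa [← pow_two])
  have h4 : b.den = 1 := by
    have := Int.isUnit_iff.mp h3
    omega
  exact ⟨b.num, by rw [Rat.coe_int_num_of_den_eq_one h4]⟩

/-- Integers of `ℚ(√d)` have half-integral coordinates, and integral norm. -/
lemma integer_form (d : ℤ) (hd : d < 0) (hs : Squarefree (-d)) (x : 𝓞 (Qsqrt d)) :
    ∃ A B n : ℤ, 2 * ((x : Qsqrt d) : ℂ) = A + B * sqrtC d ∧ 4 * n = A ^ 2 - d * B ^ 2 ∧
      Complex.normSq ((x : Qsqrt d) : ℂ) = n := by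
  obtain ⟨a, b, hab⟩ := mem_Qsqrt d _ (x : Qsqrt d).2
  have hint : IsIntegral ℤ ((x : Qsqrt d) : ℂ) := by
    have := x.isIntegral_coe
    exact this.map (Qsqrt d).val
  set z : ℂ := ((x : Qsqrt d) : ℂ) with hz
  have hconj : IsIntegral ℤ ((starRingEnd ℂ) z) :=
    hint.map ((starRingEnd ℂ).toIntAlgHom)
  have hcz : (starRingEnd ℂ) z = a - b * sqrtC d := by
    rw [hab]
    simp [conj_sqrtC d hd]
    ring
  have hs2 := sqrtC_sq d
  obtain ⟨A, hA⟩ := rat_int_of_isIntegral (2 * a) (by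
    have e : ((2 * a : ℚ) : ℂ) = z + (starRingEnd ℂ) z := by
      rw [hcz, hab]; push_cast; ring
    rw [e]
    exact hint.add hconj)
  obtain ⟨n, hn⟩ := rat_int_of_isIntegral (a ^ 2 - d * b ^ 2) (by
    have e : ((a ^ 2 - d * b ^ 2 : ℚ) : ℂ) = z * (starRingEnd ℂ) z := by
      rw [hcz, hab]; push_cast
      linear_combination (b ^ 2 : ℂ) * hs2
    rw [e]
    exact hint.mul hconj)
  obtain ⟨B, hB⟩ := rat_int_of_squarefree (-d) hs (2 * b) (4 * n - A ^ 2) (by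
    push_cast
    rw [← hn, ← hA]; ring)
  refine ⟨A, B, n, ?_, ?_, ?_⟩
  · have hA' : (2 * a : ℂ) = A := by exact_mod_cast congrArg (fun q : ℚ => (q : ℂ)) hA
    have hB' : (2 * b : ℂ) = B := by exact_mod_cast congrArg (fun q : ℚ => (q : ℂ)) hB
    rw [hab, ← hA', ← hB']; ring
  · have : (4 * n : ℚ) = A ^ 2 - d * B ^ 2 := by
      rw [← hn, ← hA, ← hB]; ring
    exact_mod_cast this
  · have h1 : (Complex.normSq z : ℂ) = n := by
      rw [← Complex.mul_conj, hcz, hab]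
      have hn' : ((a : ℂ) ^ 2 - d * b ^ 2) = n := by
        exact_mod_cast congrArg (fun q : ℚ => (q : ℂ)) hn
      rw [← hn']
      linear_combination (-b ^ 2 : ℂ) * hs2
    exact_mod_cast h1

lemma sqrtC_coord_unique (d : ℤ) (hd : d < 0) (A B A' B' : ℤ)
    (h : (A : ℂ) + B * sqrtC d = A' + B' * sqrtC d) : B = B' := by
  have h2 := congrArg (starRingEnd ℂ) h
  simp [conj_sqrtC d hd] at h2
  have h3 : ((B : ℂ) - B') * sqrtC d = 0 := by linear_combination (h - h2) / 2
  rcases mul_eq_zero.mp h3 with h4 | h4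
  · have : (B : ℂ) = B' := by linear_combination h4
    exact_mod_cast this
  · have := sqrtC_sq d
    rw [h4] at this
    have : (d : ℂ) = 0 := by rw [← this]; simp
    have : d = 0 := by exact_mod_cast this
    omega

/-- If `m ≥ 3` is odd and `p` is an odd prime such that `2 m ^ p - 1` is square-free, then `p`
divides the class number of `ℚ(√(1 - 2 m ^ p))`. -/
theorem p_dvd_classNumber_of_squarefree
    (m : ℤ) (hm : 3 ≤ m) (hmodd : Odd m)
    (p : ℕ) (hp : p.Prime) (hpodd : Odd p)
    (hsf : Squarefree (2 * m ^ p - 1)) :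
    p ∣ NumberField.classNumber (Qsqrt (1 - 2 * m ^ p)) := by
  by_contra hndvd
  have hp3 : 3 ≤ p := by
    have := hp.two_le
    rcases hpodd with ⟨k, hk⟩
    omega
  have hmp : m ^ 3 ≤ m ^ p := pow_le_pow_right₀ (by omega) hp3
  have hm2 : 4 * m ^ 2 < 2 * m ^ p - 1 := by nlinarith
  obtain ⟨d, hd⟩ : ∃ d : ℤ, d = 1 - 2 * m ^ p := ⟨_, rfl⟩
  rw [← hd] at hndvd
  have hdneg : d < 0 := by nlinarith
  have hsd : Squarefree (-d) := by rw [hd]; convert hsf using 1; ring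
  have hs2 := sqrtC_sq d
  -- the square root as an integer
  have hsmem : sqrtC d ∈ Qsqrt d := IntermediateField.mem_adjoin_simple_self ℚ _
  have hsint : IsIntegral ℤ (⟨sqrtC d, hsmem⟩ : Qsqrt d) := by
    refine ⟨X ^ 2 - C d, monic_X_pow_sub_C _ two_ne_zero, ?_⟩
    rw [eval₂_sub, eval₂_C, eval₂_X_pow]
    apply Subtype.ext
    simp [hs2]
  obtain ⟨s, hs⟩ : ∃ s : 𝓞 (Qsqrt d), ((s : Qsqrt d) : ℂ) = sqrtC d :=
    ⟨⟨_, hsint⟩, rfl⟩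
  have hss : s ^ 2 = (d : 𝓞 (Qsqrt d)) := by
    apply RingOfIntegers.ext
    apply Subtype.ext
    simp [hs, hs2]
  have hdR : (d : 𝓞 (Qsqrt d)) = 1 - 2 * (m : 𝓞 (Qsqrt d)) ^ p := by
    have := congrArg (fun k : ℤ => (k : 𝓞 (Qsqrt d))) hd
    push_cast at this
    exact this
  obtain ⟨α, hα⟩ : ∃ α : 𝓞 (Qsqrt d), α = (1 - (m : 𝓞 (Qsqrt d)) ^ p) + s := ⟨_, rfl⟩
  obtain ⟨α', hα'⟩ : ∃ α' : 𝓞 (Qsqrt d), α' = (1 - (m : 𝓞 (Qsqrt d)) ^ p) - s := ⟨_, rfl⟩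
  have hmul : α * α' = ((m : 𝓞 (Qsqrt d)) ^ 2) ^ p := by
    rw [hα, hα', ← pow_mul, mul_comm 2 p, pow_mul]
    linear_combination -hss - hdR
  have hcopZ : IsCoprime ((m ^ 2) ^ p) (2 * (1 - m ^ p)) := by
    apply IsCoprime.pow_left
    apply IsCoprime.pow_left
    apply IsCoprime.mul_right
    · obtain ⟨k, hk⟩ := hmodd
      exact ⟨1, -k, by rw [hk]; ring⟩
    · obtain ⟨q, rfl⟩ : ∃ q, p = q + 1 := ⟨p - 1, by omega⟩
      exact ⟨m ^ q, 1, by ring⟩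
  have hcop : IsCoprime α α' := by
    have h1 := hcopZ.map (Int.castRingHom (𝓞 (Qsqrt d)))
    have h2 : IsCoprime (α * α') (α' + α) := by
      rw [hmul]
      convert h1 using 1
      · simp
      · rw [hα, hα']; simp; ring
    have h3 := h2.of_mul_left_left
    rwa [show α' + α = α' + α * 1 by ring, IsCoprime.add_mul_left_right_iff] at h3
  obtain ⟨J, hJ⟩ := exists_eq_pow_of_mul_eq_pow_of_coprime
    (a := Ideal.span {α}) (b := Ideal.span {α'}) (c := Ideal.span {(m : 𝓞 (Qsqrt d)) ^ 2}) (n := p)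
    ((Ideal.isCoprime_span_singleton_iff _ _).mpr hcop)
    (by rw [Ideal.span_singleton_mul_span_singleton, hmul, Ideal.span_singleton_pow])
  have hJp : J.IsPrincipal := by
    apply Ideal.IsPrincipal.of_isPrincipal_pow_of_coprime (n := p)
    · exact (Nat.Prime.coprime_iff_not_dvd hp).mpr hndvd
    · rw [← hJ]; exact ⟨α, rfl⟩
  obtain ⟨β, hβ⟩ := hJp
  rw [hβ, Ideal.submodule_span_eq, Ideal.span_singleton_pow,
    Ideal.span_singleton_eq_span_singleton] at hJ
  obtain ⟨u, hu⟩ := hJ.symm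
  obtain ⟨A, B, n, hA, hABn, hn⟩ := integer_form d hdneg hsd β
  obtain ⟨_, _, nu, -, -, hnu⟩ := integer_form d hdneg hsd (u : 𝓞 (Qsqrt d))
  obtain ⟨_, _, nv, -, -, hnv⟩ := integer_form d hdneg hsd ((u⁻¹ : (𝓞 (Qsqrt d))ˣ) : 𝓞 (Qsqrt d))
  -- the unit has norm one
  have huv : nu * nv = 1 := by
    have h1 : (u : 𝓞 (Qsqrt d)) * ((u⁻¹ : (𝓞 (Qsqrt d))ˣ) : 𝓞 (Qsqrt d)) = 1 := u.mul_inv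
    have h2 := congrArg (fun x : 𝓞 (Qsqrt d) => Complex.normSq ((x : Qsqrt d) : ℂ)) h1
    simp only [map_mul, map_one, MulMemClass.coe_mul, OneMemClass.coe_one, hnu, hnv] at h2
    exact_mod_cast h2
  have hnu0 : 0 ≤ nu := by
    have := Complex.normSq_nonneg (((u : 𝓞 (Qsqrt d)) : Qsqrt d) : ℂ)
    rw [hnu] at this
    exact_mod_cast this
  have hnu1 : nu = 1 := by
    rcases Int.eq_one_or_neg_one_of_mul_eq_one huv with h | h <;> omega
  have hn0 : 0 ≤ n := by
    have := Complex.normSq_nonneg ((β : Qsqrt d) : ℂ)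
    rw [hn] at this
    exact_mod_cast this
  have hαC : ((α : Qsqrt d) : ℂ) = (1 - (m : ℂ) ^ p) + sqrtC d := by
    rw [hα, ← hs]
    simp
  have hαn : Complex.normSq ((α : Qsqrt d) : ℂ) = ((m : ℝ) ^ 2) ^ p := by
    have h1 : (Complex.normSq ((α : Qsqrt d) : ℂ) : ℂ) = ((m : ℂ) ^ 2) ^ p := by
      have hdC : (d : ℂ) = 1 - 2 * (m : ℂ) ^ p := by rw [hd]; push_cast; ring
      rw [← Complex.mul_conj, hαC, ← pow_mul, mul_comm 2 p, pow_mul]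
      simp only [map_add, map_sub, map_one, map_pow, conj_sqrtC d hdneg, map_intCast]
      linear_combination -hs2 - hdC
    exact_mod_cast h1
  have hnp : n ^ p = (m ^ 2) ^ p := by
    have h2 := congrArg (fun x : 𝓞 (Qsqrt d) => Complex.normSq ((x : Qsqrt d) : ℂ)) hu
    simp only [map_mul, map_pow, MulMemClass.coe_mul, SubmonoidClass.coe_pow, hnu, hn, hαn,
      hnu1] at h2
    push_cast at h2
    rw [mul_one] at h2
    exact_mod_cast h2
  have hnm : n = m ^ 2 := by
    exact (pow_left_inj₀ hn0 (by positivity) (by omega)).mp hnp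
  have hB : B = 0 := by
    by_contra hB
    have : 1 ≤ B ^ 2 := by
      have := sq_nonneg B
      have h0 : B ^ 2 ≠ 0 := pow_ne_zero _ hB
      omega
    nlinarith [sq_nonneg A]
  have hAm : A ^ 2 = 4 * m ^ 2 := by
    rw [hB, hnm] at hABn
    linarith
  have hdvd : β ∣ α := by
    rw [← hu]
    exact Dvd.dvd.mul_right (dvd_pow_self β (by omega)) _
  obtain ⟨γ, hγ⟩ := hdvd
  obtain ⟨C', E, -, hC, -, -⟩ := integer_form d hdneg hsd γ
  have hAE : A * E = 4 := by
    have h2 := congrArg (fun x : 𝓞 (Qsqrt d) => ((x : Qsqrt d) : ℂ)) hγ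
    simp only [map_mul, MulMemClass.coe_mul] at h2
    rw [hαC] at h2
    refine sqrtC_coord_unique d hdneg (A * C') (A * E) (4 * (1 - m ^ p)) 4 ?_
    rw [hB] at hA
    push_cast at hA ⊢
    linear_combination (-4 : ℂ) * h2 - 2 * ((γ : Qsqrt d) : ℂ) * hA - (A : ℂ) * hC
  have hE : E ≠ 0 := by rintro rfl; simp at hAE
  have hE2 : 1 ≤ E ^ 2 := by
    have := sq_nonneg E
    have h0 : E ^ 2 ≠ 0 := pow_ne_zero _ hE
    omega
  have h16 : A ^ 2 * E ^ 2 = 16 := by rw [← mul_pow, hAE]; norm_num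
  nlinarith
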